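/- arXiv:1605.09729 — 6 statements merged into one kernel-verified Lean document; each statement's English description precedes it below -/
import Mathlib

section
/- For every integer i ≥ 1 there exist unique rational numbers d_{i,0}, d_{i,1}, …, d_{i,i}, independent of a, such that for every nonzero real a the Grover recurrence value t_{i0} equals Σ_{j=0}^{i} d_{i,j}·a^{−(2j+1)}. Moreover these coefficients alternate in sign with (−1)^j·d_{i,j} > 0 for all 0 ≤ j ≤ i, and satisfy d_{i,0} = 2i+1, d_{i,1} = −(2/3)·i·(i+1)·(2i+1), and d_{i,i} = (−1)^i·4^i. -/
open Finset in
/-- Closed forms of the two coupled Grover polynomials in `x = 1 / a ^ 2`, summed over any range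
long enough to contain all nonzero coefficients. -/
theorem grover_amplitudes_eq_sum {P Q : ℕ → ℝ} {x c : ℝ} (hP : P 0 = c) (hQ : Q 0 = c)
    (hP' : ∀ i, P (i + 1) = P i + 2 * Q i - 2 * x * (P i + Q i))
    (hQ' : ∀ i, Q (i + 1) = Q i - 2 * x * (P i + Q i)) (i : ℕ) :
    ∀ N, i < N →
      P i = ∑ j ∈ range N,
        (-4 : ℝ) ^ j * ((i + j).choose (2 * j) + 2 * (i + j).choose (2 * j + 1)) * (c * x ^ j) ∧
      Q i = ∑ j ∈ range N, (-4 : ℝ) ^ j * (i + j).choose (2 * j) * (c * x ^ j) := by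
  induction i with
  | zero =>
    intro N hN
    obtain ⟨M, rfl⟩ : ∃ M, N = M + 1 := ⟨N - 1, by omega⟩
    have h1 (j : ℕ) : (0 + (j + 1)).choose (2 * (j + 1)) = 0 :=
      Nat.choose_eq_zero_of_lt (by omega)
    have h2 (j : ℕ) : (0 + (j + 1)).choose (2 * (j + 1) + 1) = 0 :=
      Nat.choose_eq_zero_of_lt (by omega)
    simp only [sum_range_succ', h1, h2]
    simp [hP, hQ]
  | succ i ih =>
    intro N hN
    obtain ⟨M, rfl⟩ : ∃ M, N = M + 1 := ⟨N - 1, by omega⟩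
    obtain ⟨hPM, hQM⟩ := ih M (by omega)
    obtain ⟨hPS, hQS⟩ := ih (M + 1) (by omega)
    have hx : 2 * x * (P i + Q i) = ∑ j ∈ range M,
        (-4 : ℝ) ^ j * 4 * (i + j + 1).choose (2 * j + 1) * (c * x ^ (j + 1)) := by
      rw [hPM, hQM, ← sum_add_distrib, mul_sum]
      refine sum_congr rfl fun j _ => ?_
      rw [Nat.choose_succ_succ]
      push_cast
      ring
    have e0 (j : ℕ) : i + (j + 1) = i + j + 1 := rfl
    have e1 (j : ℕ) : i + 1 + (j + 1) = i + j + 1 + 1 := by ring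
    have e2 (j : ℕ) : 2 * (j + 1) = 2 * j + 1 + 1 := rfl
    constructor
    · rw [hP', hx, hPS, hQS, sum_range_succ', sum_range_succ', sum_range_succ']
      have : ∀ A B C A0 B0 D D0 : ℝ, D = A + 2 * B - C → D0 = A0 + 2 * B0 →
          A + A0 + 2 * (B + B0) - C = D + D0 := by intros; linarith
      apply this
      · rw [mul_sum, ← sum_add_distrib, ← sum_sub_distrib]
        refine sum_congr rfl fun j _ => ?_
        rw [e1, e0, e2, Nat.choose_succ_succ (i + j + 1) (2 * j + 1),
          Nat.choose_succ_succ (i + j + 1) (2 * j + 1 + 1)]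
        push_cast
        ring
      · simp
        ring
    · rw [hQ', hx, hQS, sum_range_succ', sum_range_succ', add_sub_right_comm, ← sum_sub_distrib]
      congr 1
      · refine sum_congr rfl fun j _ => ?_
        rw [e1, e0, e2, Nat.choose_succ_succ (i + j + 1) (2 * j + 1)]
        push_cast
        ring
      · simp

theorem cast_choose_two_add_two_mul_choose_three (n : ℕ) :
    (((n + 1).choose 2 : ℚ) + 2 * (n + 1).choose 3) = n * (n + 1) * (2 * n + 1) / 6 := by
  induction n with
  | zero => simp [Nat.choose]
  | succ n ih =>
    rw [Nat.choose_succ_succ (n + 1) 1, Nat.choose_succ_succ (n + 1) 2, Nat.choose_one_right]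
    have := Nat.cast_choose_two ℚ (n + 1)
    push_cast at this ⊢
    linarith

theorem zpow_neg_two_mul_add_one {a : ℝ} (ha : a ≠ 0) (j : ℕ) :
    a ^ (-(2 * (j : ℤ) + 1)) = 1 / a * (1 / a ^ 2) ^ j := by
  rw [zpow_neg, zpow_add₀ ha, zpow_mul, zpow_natCast, zpow_one, mul_inv, one_div, one_div,
    inv_pow, mul_comm]
  norm_cast

open Finset in
theorem coeff_eq_of_forall_sum_odd_zpow_eq {d e : ℕ → ℚ} {N : ℕ}
    (h : ∀ a : ℝ, a ≠ 0 → ∑ j ∈ range N, (d j : ℝ) * a ^ (-(2 * (j : ℤ) + 1)) =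
      ∑ j ∈ range N, (e j : ℝ) * a ^ (-(2 * (j : ℤ) + 1))) {j : ℕ} (hj : j < N) :
    d j = e j := by
  have key : (∑ j ∈ range N, Polynomial.monomial j (d j : ℝ)) =
      ∑ j ∈ range N, Polynomial.monomial j (e j : ℝ) := by
    refine Polynomial.eq_of_infinite_eval_eq _ _ ((Set.Ioi_infinite (0 : ℝ)).mono fun x hx => ?_)
    have hx : 0 < x := hx
    have ha : (√x)⁻¹ ≠ 0 := by positivity
    have hsq : 1 / (√x)⁻¹ ^ 2 = x := by rw [inv_pow, Real.sq_sqrt hx.le]; simp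
    have := h _ ha
    simp only [zpow_neg_two_mul_add_one ha, hsq, mul_left_comm _ (1 / (√x)⁻¹), ← mul_sum] at this
    simpa [Polynomial.eval_finsetSum] using mul_left_cancel₀ (one_div_ne_zero ha) this
  have := congrArg (fun p => p.coeff j) key
  simpa [Polynomial.finsetSum_coeff, Polynomial.coeff_monomial, hj] using this


/-- Lemma 2 of the paper, the `t_{i0}` part: for every `i ≥ 1`
there exist unique rationals `d i 0, …, d i i`, independent of `a`, with
`t_{i0}(a) = Σ_{j=0}^{i} d j * a^{-(2j+1)}` for all nonzero real `a`; the
coefficients alternate in sign, and `d 0 = 2i+1`,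
`d 1 = -(2/3) i (i+1) (2i+1)`, `d i = (-1)^i 4^i`. -/
theorem grover_marked_amplitude_expansion
    (T T0 : ℝ → ℕ → ℝ)
    (hinit : ∀ a : ℝ, a ≠ 0 → T a 0 = 1 / a ∧ T0 a 0 = 1 / a)
    (hrec0 : ∀ a : ℝ, a ≠ 0 → ∀ i,
      T0 a (i + 1) = -2 * T0 a i / a ^ 2 - 2 * T a i / a ^ 2 + 2 * T a i + T0 a i)
    (hrec : ∀ a : ℝ, a ≠ 0 → ∀ i,
      T a (i + 1) = -2 * T0 a i / a ^ 2 - 2 * T a i / a ^ 2 + T a i)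
    (i : ℕ) (hi : 1 ≤ i) :
    ∃ d : ℕ → ℚ,
      (∀ a : ℝ, a ≠ 0 →
        T0 a i = ∑ j ∈ Finset.range (i + 1), (d j : ℝ) * a ^ (-(2 * (j : ℤ) + 1))) ∧
      (∀ d' : ℕ → ℚ,
        (∀ a : ℝ, a ≠ 0 →
          T0 a i = ∑ j ∈ Finset.range (i + 1), (d' j : ℝ) * a ^ (-(2 * (j : ℤ) + 1))) →
        ∀ j ≤ i, d' j = d j) ∧
      (∀ j ≤ i, 0 < (-1) ^ j * d j) ∧
      d 0 = 2 * i + 1 ∧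
      d 1 = -(2 / 3) * i * (i + 1) * (2 * i + 1) ∧
      d i = (-1) ^ i * 4 ^ i := by
  have expansion : ∀ a : ℝ, a ≠ 0 → T0 a i = ∑ j ∈ Finset.range (i + 1),
      (((-4) ^ j * ((i + j).choose (2 * j) + 2 * (i + j).choose (2 * j + 1)) : ℚ) : ℝ) *
        a ^ (-(2 * (j : ℤ) + 1)) := by
    intro a ha
    rw [(grover_amplitudes_eq_sum (x := 1 / a ^ 2) (hinit a ha).2 (hinit a ha).1
      (fun i => by rw [hrec0 a ha]; ring) (fun i => by rw [hrec a ha]; ring)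
      i (i + 1) i.lt_succ_self).1]
    refine Finset.sum_congr rfl fun j _ => ?_
    rw [zpow_neg_two_mul_add_one ha]
    push_cast
    ring
  refine ⟨fun j => (-4) ^ j * ((i + j).choose (2 * j) + 2 * (i + j).choose (2 * j + 1)),
    expansion, fun d' hd' j hj => ?_, fun j hj => ?_, ?_, ?_, ?_⟩
  · exact coeff_eq_of_forall_sum_odd_zpow_eq
      (fun a ha => (hd' a ha).symm.trans (expansion a ha)) (Nat.lt_succ_of_le hj)
  · have : 0 < (i + j).choose (2 * j) := Nat.choose_pos (by omega)
    rw [← mul_assoc, ← mul_pow]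
    norm_num
    positivity
  · simp
    ring
  · have := cast_choose_two_add_two_mul_choose_three i
    norm_num
    rw [this]
    ring
  · simp only [← two_mul, Nat.choose_self]
    rw [← mul_pow]
    norm_num
end

section
/- For every integer i ≥ 1 there exist unique rational numbers e_{i,0}, e_{i,1}, …, e_{i,i}, independent of a, such that for every nonzero real a the Grover recurrence value t_i equals Σ_{j=0}^{i} e_{i,j}·a^{−(2j+1)}. Moreover these coefficients alternate in sign with (−1)^j·e_{i,j} > 0 for all 0 ≤ j ≤ i, and satisfy e_{i,0} = 1, e_{i,1} = −2·i·(i+1), e_{i,2} = (2/3)·i·(i+2)·(i²−1) whenever i ≥ 2, and e_{i,i} = (−1)^i·4^i. -/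
theorem Nat.choose_add_two_add_choose (n k : ℕ) :
    (n + 2).choose (k + 2) + n.choose (k + 2) = 2 * (n + 1).choose (k + 2) + n.choose k := by
  have h1 := Nat.choose_succ_succ' (n + 1) (k + 1)
  have h2 := Nat.choose_succ_succ' n (k + 1)
  have h3 := Nat.choose_succ_succ' n k
  simp only [add_assoc, Nat.reduceAdd] at h1 h2 h3
  omega

/-- The coefficient of `a ^ (-(2 * j + 1))` in the amplitude after `i` Grover iterations. -/
def groverCoeff (i j : ℕ) : ℚ := (-4) ^ j * (i + j).choose (2 * j)

theorem groverCoeff_zero_right (i : ℕ) : groverCoeff i 0 = 1 := by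
  simp [groverCoeff]

theorem groverCoeff_eq_zero_of_lt {i j : ℕ} (h : i < j) : groverCoeff i j = 0 := by
  simp [groverCoeff, Nat.choose_eq_zero_of_lt (show i + j < 2 * j by omega)]

theorem groverCoeff_self (i : ℕ) : groverCoeff i i = (-4) ^ i := by
  simp [groverCoeff, ← two_mul]

theorem groverCoeff_one_right (i : ℕ) : groverCoeff i 1 = -2 * i * (i + 1) := by
  simp only [groverCoeff, mul_one, pow_one, Nat.cast_choose_two]
  push_cast
  ring

theorem groverCoeff_two_right (i : ℕ) :
    groverCoeff i 2 = (2 / 3) * i * (i + 2) * ((i : ℚ) ^ 2 - 1) := by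
  rcases i with _ | i
  · simp [groverCoeff_eq_zero_of_lt]
  · have h := Nat.descFactorial_eq_factorial_mul_choose (i + 3) 4
    have h' : ((i + 3) * (i + 2) * (i + 1) * i : ℚ) = 24 * (i + 3).choose 4 := by
      have h'' : (i + 3) * (i + 2) * (i + 1) * i = 24 * (i + 3).choose 4 := by
        simp [Nat.descFactorial_succ, Nat.factorial] at h
        linarith
      exact_mod_cast h''
    have e : i + 1 + 2 = i + 3 := rfl
    simp only [groverCoeff, Nat.reduceMul, e]
    push_cast
    linear_combination (-2 / 3) * h'

theorem groverCoeff_alternating {i j : ℕ} (h : j ≤ i) : 0 < (-1) ^ j * groverCoeff i j := by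
  rw [groverCoeff, ← mul_assoc, ← mul_pow]
  norm_num
  exact Nat.choose_pos (by omega)

theorem groverCoeff_add_two (i j : ℕ) :
    groverCoeff (i + 2) (j + 1) =
      2 * groverCoeff (i + 1) (j + 1) - 4 * groverCoeff (i + 1) j - groverCoeff i (j + 1) := by
  have h := Nat.choose_add_two_add_choose (i + j + 1) (2 * j)
  have h' : ((i + j + 1 + 2).choose (2 * j + 2) + (i + j + 1).choose (2 * j + 2) : ℚ) =
      2 * (i + j + 1 + 1).choose (2 * j + 2) + (i + j + 1).choose (2 * j) := by
    exact_mod_cast h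
  have e1 : i + 2 + (j + 1) = i + j + 1 + 2 := by ring
  have e2 : i + 1 + (j + 1) = i + j + 1 + 1 := by ring
  have e3 : i + 1 + j = i + j + 1 := by ring
  have e4 : i + (j + 1) = i + j + 1 := by ring
  simp only [groverCoeff, e1, e2, e3, e4, mul_add, mul_one]
  linear_combination (-4) ^ (j + 1) * h'

/-- The generating polynomial of `groverCoeff i`. -/
noncomputable def groverPoly (i : ℕ) (x : ℝ) : ℝ :=
  ∑ j ∈ Finset.range (i + 1), (groverCoeff i j : ℝ) * x ^ j

theorem groverPoly_eq_sum_range {i n : ℕ} (h : i < n) (x : ℝ) :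
    groverPoly i x = ∑ j ∈ Finset.range n, (groverCoeff i j : ℝ) * x ^ j := by
  refine Finset.sum_subset (Finset.range_subset_range.2 h) fun j _ hj => ?_
  rw [groverCoeff_eq_zero_of_lt (by simpa using hj)]
  simp

theorem groverPoly_add_two (i : ℕ) (x : ℝ) :
    groverPoly (i + 2) x = (2 - 4 * x) * groverPoly (i + 1) x - groverPoly i x := by
  have key : ∀ j, (groverCoeff (i + 2) (j + 1) : ℝ) * x ^ (j + 1) =
      2 * ((groverCoeff (i + 1) (j + 1) : ℝ) * x ^ (j + 1)) -
        4 * x * ((groverCoeff (i + 1) j : ℝ) * x ^ j) -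
        (groverCoeff i (j + 1) : ℝ) * x ^ (j + 1) := fun j => by
    rw [groverCoeff_add_two]
    push_cast
    ring
  have h1 := groverPoly_eq_sum_range (show i + 1 < i + 2 + 1 by omega) x
  have h2 : groverPoly (i + 1) x = _ := rfl
  rw [groverPoly_eq_sum_range (show i < i + 2 + 1 by omega)]
  rw [groverPoly, Finset.sum_range_succ', Finset.sum_range_succ' _ (i + 2)]
  rw [Finset.sum_range_succ'] at h1
  simp only [key, Finset.sum_sub_distrib, ← Finset.mul_sum, groverCoeff_zero_right,
    groverPoly] at h1 ⊢
  push_cast at h1 ⊢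
  linear_combination -2 * h1

theorem eq_groverPoly_div {a : ℝ} {t t0 : ℕ → ℝ} (hinit : t 0 = 1 / a)
    (hinit0 : t0 0 = 1 / a)
    (hrec0 : ∀ i, t0 (i + 1) = -2 * t0 i / a ^ 2 - 2 * t i / a ^ 2 + 2 * t i + t0 i)
    (hrec : ∀ i, t (i + 1) = -2 * t0 i / a ^ 2 - 2 * t i / a ^ 2 + t i) (i : ℕ) :
    t i = groverPoly i (1 / a ^ 2) / a := by
  induction i using Nat.twoStepInduction with
  | zero => simp [groverPoly, groverCoeff, hinit]
  | one =>
    rw [hrec, hinit, hinit0]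
    simp [groverPoly, groverCoeff, Finset.sum_range_succ]
    ring
  | more i h0 h1 =>
    have h : t (i + 2) = (2 - 4 * (1 / a ^ 2)) * t (i + 1) - t i := by
      have h2 := hrec (i + 1)
      rw [hrec0 i] at h2
      rw [h2]
      have h3 := hrec i
      linear_combination (-1 + 2 / a ^ 2) * h3
    rw [h, h0, h1, groverPoly_add_two]
    ring

theorem sum_mul_zpow_neg_eq (c : ℕ → ℚ) (n : ℕ) (a : ℝ) :
    ∑ j ∈ Finset.range n, (c j : ℝ) * a ^ (-(2 * (j : ℤ) + 1)) =
      (∑ j ∈ Finset.range n, (c j : ℝ) * (1 / a ^ 2) ^ j) / a := by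
  rw [Finset.sum_div]
  refine Finset.sum_congr rfl fun j _ => ?_
  have h : a ^ (2 * (j : ℤ) + 1) = (a ^ 2) ^ j * a := by
    rw [← pow_mul]
    exact_mod_cast pow_succ a (2 * j)
  rw [zpow_neg, h, one_div, inv_pow, mul_inv, div_eq_mul_inv, mul_assoc]

theorem coeff_eq_of_sum_mul_pow_eq_of_pos {c d : ℕ → ℝ} {n : ℕ}
    (h : ∀ x : ℝ, 0 < x →
      ∑ j ∈ Finset.range n, c j * x ^ j = ∑ j ∈ Finset.range n, d j * x ^ j)
    {j : ℕ} (hj : j < n) : c j = d j := by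
  have hp : (∑ k ∈ Finset.range n, Polynomial.monomial k (c k)) =
      ∑ k ∈ Finset.range n, Polynomial.monomial k (d k) := by
    refine Polynomial.eq_of_infinite_eval_eq _ _
      ((Set.Ioi_infinite (0 : ℝ)).mono fun x hx => ?_)
    simpa [Polynomial.eval_finsetSum] using h x hx
  simpa [Polynomial.finsetSum_coeff, Polynomial.coeff_monomial, hj] using
    congrArg (fun p => Polynomial.coeff p j) hp


/-- Lemma 2 of the paper, the `t_i` part: for every `i ≥ 1`
there exist unique rationals `e i 0, …, e i i`, independent of `a`, with
`t_i(a) = Σ_{j=0}^{i} e j * a^{-(2j+1)}` for all nonzero real `a`; the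
coefficients alternate in sign, and `e 0 = 1`, `e 1 = -2 i (i+1)`,
`e 2 = (2/3) i (i+2) (i²-1)` whenever `i ≥ 2`, and `e i = (-1)^i 4^i`. -/
theorem grover_unmarked_amplitude_expansion
    (T T0 : ℝ → ℕ → ℝ)
    (hinit : ∀ a : ℝ, a ≠ 0 → T a 0 = 1 / a ∧ T0 a 0 = 1 / a)
    (hrec0 : ∀ a : ℝ, a ≠ 0 → ∀ i,
      T0 a (i + 1) = -2 * T0 a i / a ^ 2 - 2 * T a i / a ^ 2 + 2 * T a i + T0 a i)
    (hrec : ∀ a : ℝ, a ≠ 0 → ∀ i,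
      T a (i + 1) = -2 * T0 a i / a ^ 2 - 2 * T a i / a ^ 2 + T a i)
    (i : ℕ) (hi : 1 ≤ i) :
    ∃ e : ℕ → ℚ,
      (∀ a : ℝ, a ≠ 0 →
        T a i = ∑ j ∈ Finset.range (i + 1), (e j : ℝ) * a ^ (-(2 * (j : ℤ) + 1))) ∧
      (∀ e' : ℕ → ℚ,
        (∀ a : ℝ, a ≠ 0 →
          T a i = ∑ j ∈ Finset.range (i + 1), (e' j : ℝ) * a ^ (-(2 * (j : ℤ) + 1))) →
        ∀ j ≤ i, e' j = e j) ∧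
      (∀ j ≤ i, 0 < (-1) ^ j * e j) ∧
      e 0 = 1 ∧
      e 1 = -2 * i * (i + 1) ∧
      (2 ≤ i → e 2 = (2 / 3) * i * (i + 2) * ((i : ℚ) ^ 2 - 1)) ∧
      e i = (-1) ^ i * 4 ^ i := by
  have hT : ∀ a : ℝ, a ≠ 0 → T a i = groverPoly i (1 / a ^ 2) / a := fun a ha =>
    eq_groverPoly_div (hinit a ha).1 (hinit a ha).2 (hrec0 a ha) (hrec a ha) i
  refine ⟨groverCoeff i, fun a ha => ?_, fun e' he' j hj => ?_,
    fun j hj => groverCoeff_alternating hj, groverCoeff_zero_right i, groverCoeff_one_right i,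
    fun _ => groverCoeff_two_right i, ?_⟩
  · rw [hT a ha, sum_mul_zpow_neg_eq, groverPoly]
  · have h : (e' j : ℝ) = groverCoeff i j := by
      refine coeff_eq_of_sum_mul_pow_eq_of_pos (c := fun k => (e' k : ℝ))
        (d := fun k => (groverCoeff i k : ℝ)) (n := i + 1) (fun x hx => ?_) (by omega)
      have ha : (√x)⁻¹ ≠ 0 := inv_ne_zero (Real.sqrt_ne_zero'.2 hx)
      have hx' : 1 / ((√x)⁻¹) ^ 2 = x := by
        rw [inv_pow, Real.sq_sqrt hx.le, one_div, inv_inv]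
      have h1 := he' _ ha
      rw [hT _ ha, sum_mul_zpow_neg_eq, hx', div_left_inj' ha] at h1
      exact h1.symm
    exact_mod_cast h
  · rw [groverCoeff_self, ← mul_pow]
    norm_num
end

section
/- For every integer i with i ≥ 2 and every real number a with a ≥ i, the sequences defined by the Grover recurrence satisfy the strict inequality a²·t_i − t_{i0} < a − (2i² + 4i + 1)/a + ((2/3)i⁴ + (8/3)i³ + (4/3)i² − (2/3)i)/a³. -/
/-- The quadratic truncation in `s` of a solution of `w (n + 2) = (2 - 4 * s) * w (n + 1) - w n`
bounds it from above, and the linear truncation bounds it from below, as long as `n ^ 2 * s ≤ 1`;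
both gaps are nondecreasing. -/
lemma truncation_gaps_monotone {s : ℝ} (hs : 0 < s) {w p q : ℕ → ℝ}
    (hw0 : w 0 = 1 - s) (hw1 : w 1 = 1 - 7 * s + 4 * s ^ 2)
    (hw : ∀ n, w (n + 2) = (2 - 4 * s) * w (n + 1) - w n)
    (hp : ∀ n, p n = 1 - (2 * (n : ℝ) ^ 2 + 4 * n + 1) * s)
    (hq : ∀ n, q n = p n +
      ((2 / 3) * (n : ℝ) ^ 4 + (8 / 3) * n ^ 3 + (4 / 3) * n ^ 2 - (2 / 3) * n) * s ^ 2)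
    (n : ℕ) (hn : ((n : ℝ) + 1) ^ 2 * s ≤ 1) :
    p (n + 1) ≤ w (n + 1) ∧ w (n + 1) - p (n + 1) ≤ w (n + 2) - p (n + 2) ∧
      w (n + 1) ≤ q (n + 1) ∧ q (n + 1) - w (n + 1) < q (n + 2) - w (n + 2) := by
  have hp2 (m : ℕ) : p (m + 2) = 2 * p (m + 1) - p m - 4 * s := by
    simp only [hp]; push_cast; ring
  have hq2 (m : ℕ) : q (m + 2) = 2 * q (m + 1) - q m - 4 * s * p (m + 1) := by
    simp only [hq, hp]; push_cast; ring
  induction n with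
  | zero =>
    have hs3 : 0 < s ^ 3 := by positivity
    have hw2 := hw 0
    norm_num [hw0, hw1] at hw2
    have hs2 : 0 < s ^ 2 := by positivity
    have hs4 : s ^ 3 ≤ s ^ 2 :=
      pow_le_pow_of_le_one hs.le (by simpa using hn) (by norm_num)
    refine ⟨?_, ?_, ?_, ?_⟩ <;> norm_num [hq, hp, hw1, hw2] <;> linarith
  | succ n ih =>
    push_cast at hn
    have hx : (0 : ℝ) ≤ n := n.cast_nonneg
    obtain ⟨h1, h2, h3, h4⟩ := ih (le_trans (by gcongr; linarith) hn)
    have hq1 : q (n + 2) ≤ 1 := by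
      have hc : q (n + 2) = 1 - s * (2 * ((n : ℝ) + 2) ^ 2 + 4 * (n + 2) + 1 -
          ((2 / 3) * ((n : ℝ) + 2) ^ 2 + (8 / 3) * (n + 2) + 4 / 3) * ((n + 1 + 1) ^ 2 * s)) -
          (2 / 3) * (n + 2) * s ^ 2 := by
        simp only [hq, hp]; push_cast; ring
      have hm := mul_le_mul_of_nonneg_left hn
        (by positivity : (0 : ℝ) ≤ (2 / 3) * ((n : ℝ) + 2) ^ 2 + (8 / 3) * (n + 2) + 4 / 3)
      have hb : 0 ≤ 2 * ((n : ℝ) + 2) ^ 2 + 4 * (n + 2) + 1 -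
          ((2 / 3) * ((n : ℝ) + 2) ^ 2 + (8 / 3) * (n + 2) + 4 / 3) * ((n + 1 + 1) ^ 2 * s) := by
        nlinarith
      have := mul_nonneg hs.le hb
      have : 0 ≤ (2 / 3) * ((n : ℝ) + 2) * s ^ 2 := by positivity
      linarith
    have hgap := mul_nonneg hs.le (by linarith : 0 ≤ 1 - w (n + 2))
    have hgap' := mul_nonneg hs.le (by linarith : 0 ≤ w (n + 2) - p (n + 2))
    have hw3 := hw (n + 1)
    have hp3 := hp2 (n + 1)
    have hq3 := hq2 (n + 1)
    simp only [add_assoc, Nat.reduceAdd] at hw3 hp3 hq3 ⊢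
    refine ⟨by linarith, ?_, by linarith, ?_⟩ <;> linarith

/-- Eq. (44)–(45) in the proof of Theorem 1 of the paper:
for `i ≥ 2` and `a ≥ i`,
`a² tᵢ − t_{i0} < a − (2i² + 4i + 1)/a + ((2/3)i⁴ + (8/3)i³ + (4/3)i² − (2/3)i)/a³`. -/
theorem grover_difference_upper_bound
    (a : ℝ) (ha : 2 ≤ a)
    (t t0 : ℕ → ℝ)
    (ht : t 0 = 1 / a) (ht0 : t0 0 = 1 / a)
    (hrec0 : ∀ i, t0 (i + 1) = -2 * t0 i / a ^ 2 - 2 * t i / a ^ 2 + 2 * t i + t0 i)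
    (hrec : ∀ i, t (i + 1) = -2 * t0 i / a ^ 2 - 2 * t i / a ^ 2 + t i)
    (i : ℕ) (hi : 2 ≤ i) (hai : (i : ℝ) ≤ a) :
    a ^ 2 * t i - t0 i <
      a - (2 * (i : ℝ) ^ 2 + 4 * i + 1) / a +
        ((2 / 3) * (i : ℝ) ^ 4 + (8 / 3) * i ^ 3 + (4 / 3) * i ^ 2 - (2 / 3) * i) / a ^ 3 := by
  have ha0 : 0 < a := by linarith
  let p : ℕ → ℝ := fun n => 1 - (2 * (n : ℝ) ^ 2 + 4 * n + 1) * (1 / a ^ 2)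
  let q : ℕ → ℝ := fun n => p n +
    ((2 / 3) * (n : ℝ) ^ 4 + (8 / 3) * n ^ 3 + (4 / 3) * n ^ 2 - (2 / 3) * n) * (1 / a ^ 2) ^ 2
  obtain ⟨n, rfl⟩ := Nat.exists_eq_add_of_le' hi
  push_cast at hai
  have hn : ((n : ℝ) + 1) ^ 2 * (1 / a ^ 2) ≤ 1 := by
    rw [mul_one_div, div_le_one (by positivity)]
    gcongr
    linarith
  obtain ⟨-, -, h3, h4⟩ := truncation_gaps_monotone (s := 1 / a ^ 2) (by positivity)
    (w := fun n => (a ^ 2 * t n - t0 n) / a) (p := p) (q := q)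
    (by simp only [ht, ht0]; field_simp)
    (by simp only [hrec 0, hrec0 0, ht, ht0]; field_simp; ring)
    (fun m => by simp only [hrec, hrec0]; field_simp; ring)
    (fun _ => rfl) (fun _ => rfl) n hn
  have h : (a ^ 2 * t (n + 2) - t0 (n + 2)) / a < q (n + 2) := by linarith
  rw [div_lt_iff₀ ha0] at h
  refine h.trans_eq ?_
  simp only [q, p]
  field_simp
end

section
/- For every integer i with i ≥ 2, every real number a with a ≥ i, if t_i ≥ 0 and the quartic inequality i⁴ + 4i³ + (2 − 3a²)i² − (1 + 6a²)i + (3/2)a⁴ − (3/2)a² < 0 holds, then t_{(i+1)0} < t_{i0}; that is, whenever the iteration number i satisfies the quartic inequality of Theorem 1, the marked-state amplitude strictly decreases at the next Grover iteration. -/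
open Real in
/-- Closed form of the Grover amplitudes, where `1 / a = sin θ`. -/
theorem grover_amplitudes_closed_form {a θ : ℝ} (hθ : sin θ = 1 / a)
    {t t0 : ℕ → ℝ} (ht : t 0 = 1 / a) (ht0 : t0 0 = 1 / a)
    (hrec0 : ∀ i, t0 (i + 1) = -2 * t0 i / a ^ 2 - 2 * t i / a ^ 2 + 2 * t i + t0 i)
    (hrec : ∀ i, t (i + 1) = -2 * t0 i / a ^ 2 - 2 * t i / a ^ 2 + t i) (i : ℕ) :
    t0 i = sin ((2 * i + 1) * θ) ∧ t i * cos θ = sin θ * cos ((2 * i + 1) * θ) := by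
  have hdiv (x : ℝ) : x / a ^ 2 = x * sin θ ^ 2 := by rw [hθ]; ring
  induction i with
  | zero => simp [ht, ht0, hθ]
  | succ k ih =>
    obtain ⟨h0, h1⟩ := ih
    have harg : (2 * ((k + 1 : ℕ) : ℝ) + 1) * θ = (2 * k + 1) * θ + 2 * θ := by
      push_cast; ring
    have hsc := sin_sq_add_cos_sq θ
    rw [harg, sin_add, cos_add, sin_two_mul, cos_two_mul, hrec0, hrec]
    simp only [hdiv]
    rw [← h0]
    constructor
    · linear_combination (2 * cos θ) * h1 - (2 * t0 k + 2 * t k) * hsc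
    · linear_combination (1 - 2 * sin θ ^ 2) * h1 -
        2 * sin θ * cos ((2 * k + 1) * θ) * hsc

/-- The quartic inequality forces `a² < 1.62 (i + 1)²`. -/
theorem sq_lt_of_grover_quartic {a x : ℝ} (hx : 2 ≤ x)
    (h : x ^ 4 + 4 * x ^ 3 + (2 - 3 * a ^ 2) * x ^ 2 - (1 + 6 * a ^ 2) * x +
      (3 / 2) * a ^ 4 - (3 / 2) * a ^ 2 < 0) :
    a ^ 2 < 1.62 * (x + 1) ^ 2 := by
  by_contra! hle
  obtain ⟨d, hd, rfl⟩ : ∃ d, 0 ≤ d ∧ x = d + 2 := ⟨x - 2, by linarith, by ring⟩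
  obtain ⟨e, he, hae⟩ : ∃ e, 0 ≤ e ∧ a ^ 2 = 1.62 * (d + 2 + 1) ^ 2 + e :=
    ⟨_, sub_nonneg.2 hle, by ring⟩
  have ha4 : a ^ 4 = (a ^ 2) ^ 2 := by ring
  rw [ha4, hae] at h
  ring_nf at h
  have : 0 ≤ e * d := by positivity
  have : 0 ≤ e * d ^ 2 := by positivity
  have : 0 ≤ d ^ 2 := by positivity
  have : 0 ≤ d ^ 3 := by positivity
  have : 0 ≤ d ^ 4 := by positivity
  have : 0 ≤ e ^ 2 := by positivity
  linarith


/-- the substantive content of Theorem 1 of the paper: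
for `i ≥ 2`, `a ≥ i`, if `tᵢ ≥ 0` and the quartic inequality
`i⁴ + 4i³ + (2 − 3a²)i² − (1 + 6a²)i + (3/2)a⁴ − (3/2)a² < 0` holds,
then the marked-state amplitude strictly decreases at the next iteration. -/
theorem grover_quartic_implies_decrease
    (a : ℝ) (ha : 2 ≤ a)
    (t t0 : ℕ → ℝ)
    (ht : t 0 = 1 / a) (ht0 : t0 0 = 1 / a)
    (hrec0 : ∀ i, t0 (i + 1) = -2 * t0 i / a ^ 2 - 2 * t i / a ^ 2 + 2 * t i + t0 i)
    (hrec : ∀ i, t (i + 1) = -2 * t0 i / a ^ 2 - 2 * t i / a ^ 2 + t i)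
    (i : ℕ) (hi : 2 ≤ i) (hai : (i : ℝ) ≤ a)
    (hnn : 0 ≤ t i)
    (hquartic : (i : ℝ) ^ 4 + 4 * (i : ℝ) ^ 3 + (2 - 3 * a ^ 2) * (i : ℝ) ^ 2 -
        (1 + 6 * a ^ 2) * (i : ℝ) + (3 / 2) * a ^ 4 - (3 / 2) * a ^ 2 < 0) :
    t0 (i + 1) < t0 i := by
  have hx : (2 : ℝ) ≤ i := by exact_mod_cast hi
  have ha0 : 0 < a := by linarith
  have hinv : 1 / a ≤ 1 / 2 := one_div_le_one_div_of_le two_pos ha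
  have hinv0 : 0 < 1 / a := by positivity
  obtain ⟨θ, hθ0, hθ2, hθ⟩ : ∃ θ, 0 < θ ∧ θ < Real.pi / 2 ∧ Real.sin θ = 1 / a :=
    ⟨Real.arcsin (1 / a), Real.arcsin_pos.2 hinv0,
      Real.arcsin_lt_pi_div_two.2 (by linarith),
      Real.sin_arcsin (by linarith) (by linarith)⟩
  have hclosed := grover_amplitudes_closed_form hθ ht ht0 hrec0 hrec
  have hlower : 1 < a * θ := by
    have h := Real.sin_lt hθ0
    rw [hθ, div_lt_iff₀ ha0] at h
    linarith
  have hupper : a * θ < Real.pi / 2 := by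
    have h := Real.mul_lt_sin hθ0 hθ2
    rw [hθ, lt_div_iff₀ ha0] at h
    have h' := mul_lt_mul_of_pos_left h Real.pi_pos
    field_simp at h'
    linarith
  have hpi : Real.pi * a < 4 * (i + 1) := by
    have h1 := sq_lt_of_grover_quartic hx hquartic
    have h2 : Real.pi ^ 2 < 9.876 := by
      nlinarith [Real.pi_lt_d4, Real.pi_pos]
    refine lt_of_pow_lt_pow_left₀ 2 (by positivity) ?_
    nlinarith [mul_le_mul_of_nonneg_right h2.le (sq_nonneg a)]
  have hneg : Real.cos ((2 * i + 2) * θ) < 0 := by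
    apply Real.cos_neg_of_pi_div_two_lt_of_lt
    · nlinarith [mul_lt_mul_of_pos_right hpi hθ0, mul_lt_mul_of_pos_left hlower Real.pi_pos]
    · nlinarith
  have hsub : t0 (i + 1) - t0 i = 2 * Real.sin θ * Real.cos ((2 * i + 2) * θ) := by
    rw [(hclosed (i + 1)).1, (hclosed i).1, Real.sin_sub_sin]
    congr 3 <;> push_cast <;> ring
  have hsin : 0 < Real.sin θ := hθ ▸ hinv0
  nlinarith [mul_neg_of_pos_of_neg hsin hneg]
end

section
/- For every integer i with 2 ≤ i and every real number a with a ≥ i, the marked-state amplitude satisfies the lower bound t_{i0} > (2i + 1)/a − (2/3)·i·(i + 1)·(2i + 1)/a³. -/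
/-- Cubic Taylor bounds for the rescaled Grover recursion with `x = 1 / a ^ 2`. -/
theorem grover_rescaled_bounds (x : ℝ) (hx : 0 < x) (s u : ℕ → ℝ)
    (hs0 : s 0 = 1) (hu0 : u 0 = 1)
    (hs : ∀ i, s (i + 1) = s i + 2 * u i - 2 * x * (s i + u i))
    (hu : ∀ i, u (i + 1) = u i - 2 * x * (s i + u i))
    (i : ℕ) (hi : 2 ≤ i) (hix : x * (i : ℝ) ^ 2 ≤ 1) :
    s i ≤ 2 * i + 1 ∧ u i ≤ 1 ∧ 1 - 2 * x * (i * (i + 1)) ≤ u i ∧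
      2 * (i : ℝ) + 1 - 2 / 3 * i * (i + 1) * (2 * i + 1) * x < s i := by
  induction i, hi using Nat.le_induction with
  | base =>
    have hs1 : s 1 = 3 - 4 * x := by rw [hs 0, hs0, hu0]; ring
    have hu1 : u 1 = 1 - 4 * x := by rw [hu 0, hs0, hu0]; ring
    have hs2 : s 2 = 5 - 20 * x + 16 * x ^ 2 := by rw [hs 1, hs1, hu1]; ring
    have hu2 : u 2 = 1 - 12 * x + 16 * x ^ 2 := by rw [hu 1, hs1, hu1]; ring
    rw [hs2, hu2]
    norm_num at hix ⊢
    refine ⟨?_, ?_, ?_, ?_⟩ <;> nlinarith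
  | succ i hi ih =>
    push_cast at hix ⊢
    have hi0 : (0 : ℝ) ≤ i := i.cast_nonneg
    obtain ⟨hs_le, hu_le, hu_ge, hs_gt⟩ := ih (by nlinarith)
    have hsum_nonneg : 0 ≤ s i + u i := by
      have hfac : 0 ≤ 2 * ((i : ℝ) + 1) * (1 - x * (i * (4 * i + 8) / 6)) :=
        mul_nonneg (by positivity) (by nlinarith)
      linarith
    have hsum_le : x * (s i + u i) ≤ x * (2 * i + 2) :=
      mul_le_mul_of_nonneg_left (by linarith) hx.le
    have hxsum : 0 ≤ x * (s i + u i) := mul_nonneg hx.le hsum_nonneg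
    rw [hs i, hu i]
    refine ⟨by linarith, by linarith, by linarith, by linarith⟩


/-- key estimate in the proof of Theorem 3 of the paper:
for `i ≥ 2` and `a ≥ i`, the marked-state amplitude satisfies
`t_{i0} > (2i + 1)/a − (2/3) i (i + 1) (2i + 1)/a³`. -/
theorem grover_marked_amplitude_lower_bound
    (a : ℝ) (ha : 2 ≤ a)
    (t t0 : ℕ → ℝ)
    (ht : t 0 = 1 / a) (ht0 : t0 0 = 1 / a)
    (hrec0 : ∀ i, t0 (i + 1) = -2 * t0 i / a ^ 2 - 2 * t i / a ^ 2 + 2 * t i + t0 i)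
    (hrec : ∀ i, t (i + 1) = -2 * t0 i / a ^ 2 - 2 * t i / a ^ 2 + t i)
    (i : ℕ) (hi : 2 ≤ i) (hai : (i : ℝ) ≤ a) :
    t0 i > (2 * (i : ℝ) + 1) / a - (2 / 3) * i * ((i : ℝ) + 1) * (2 * (i : ℝ) + 1) / a ^ 3 := by
  have ha0 : 0 < a := by linarith
  have hne : a ≠ 0 := ha0.ne'
  have hbound := (grover_rescaled_bounds (1 / a ^ 2) (by positivity)
    (fun n => a * t0 n) (fun n => a * t n)
    (by simp only [ht0]; field_simp) (by simp only [ht]; field_simp)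
    (fun n => by simp only [hrec0]; field_simp; ring)
    (fun n => by simp only [hrec]; field_simp; ring) i hi
    (by
      rw [one_div_mul_eq_div, div_le_one (by positivity)]
      exact pow_le_pow_left₀ i.cast_nonneg hai 2)).2.2.2
  refine lt_of_mul_lt_mul_left (lt_of_eq_of_lt ?_ hbound) ha0.le
  field_simp
end

section
/- For every real number a ≥ 1, setting x = 0.7962·a − 0.6057, the inequality (2x + 1)/a − (2/3)·x·(x + 1)·(2x + 1)/a³ > 0.9194 holds. (Substituting the fitted optimal iteration number î ≈ 0.7962a − 0.6057 of Theorem 2 into the lower bound of Theorem 3 shows the marked state is measured with probability at least about 0.9194² ≈ 0.845.) -/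
/-- substituting the fitted optimal iteration number
`î ≈ 0.7962 a − 0.6057` (Theorem 2 of the paper) into the lower bound of
Theorem 3 gives, for every `a ≥ 1`, a marked amplitude greater than `0.9194`
(here `0.7962 = 7962/10000` and `0.6057 = 6057/10000` exactly). -/
theorem grover_fitted_iteration_lower_bound
    (a : ℝ) (ha : 1 ≤ a) (x : ℝ) (hx : x = (7962 / 10000) * a - 6057 / 10000) :
    (2 * x + 1) / a - (2 / 3) * x * (x + 1) * (2 * x + 1) / a ^ 3 > 9194 / 10000 := by
  subst hx
  have hpos : 0 < a := by linarith
  rw [gt_iff_lt, div_sub_div _ _ hpos.ne' (by positivity), lt_div_iff₀ (by positivity)]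
  have key : 0 < (2 * ((7962 / 10000) * a - 6057 / 10000) + 1) * a ^ 2
      - (2 / 3) * ((7962 / 10000) * a - 6057 / 10000) * (((7962 / 10000) * a - 6057 / 10000) + 1)
        * (2 * ((7962 / 10000) * a - 6057 / 10000) + 1) - 9194 / 10000 * a ^ 3 := by
    nlinarith [mul_nonneg hpos.le (sub_nonneg.2 ha)]
  nlinarith [mul_pos hpos key]
end
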